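/- Let n ≥ 1 and a_i^{(α)} ∈ ℂⁿ for i ∈ {1,2}, α ∈ {1,2,3,4}, and set F_i(z) = Σ_{α=1}^4 a_i^{(α)} z^α. If condition (A)₄ holds and condition (B)_{4,c} holds for some constant c > 0, then a₁⁽⁴⁾ = 0 and a₂⁽⁴⁾ = 0. (In other words, the case W₄ ≠ 0 cannot occur: there is no such curve whose local matrix F has a nonzero degree-4 coefficient.) -/

import Mathlib

open scoped BigOperators
open Complex

noncomputable def hinner {m : ℕ} (u w : Fin m → ℂ) : ℂ :=
  ∑ i, u i * (starRingEnd ℂ) (w i)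

noncomputable def gram {m k : ℕ} (v : Fin k → Fin m → ℂ) : ℂ :=
  Matrix.det (Matrix.of fun i j : Fin k => hinner (v i) (v j))

noncomputable def vOne {n : ℕ} (F : ℂ → Fin n → ℂ) (z : ℂ) : Fin (n + 2) → ℂ :=
  Fin.cons 1 (Fin.cons 0 (F z))

noncomputable def vTwo {n : ℕ} (F : ℂ → Fin n → ℂ) (z : ℂ) : Fin (n + 2) → ℂ :=
  Fin.cons 0 (Fin.cons 1 (F z))

def IsPolyMap {n : ℕ} (F : ℂ → Fin n → ℂ) : Prop :=
  ∀ i : Fin n, ∃ p : Polynomial ℂ, ∀ z : ℂ, F z i = Polynomial.eval z p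

def CondA {n : ℕ} (d : ℕ) (F₁ F₂ : ℂ → Fin n → ℂ) : Prop :=
  ∀ z : ℂ,
    1 + hinner (F₁ z) (F₁ z) + hinner (F₂ z) (F₂ z) +
      (hinner (F₁ z) (F₁ z) * hinner (F₂ z) (F₂ z) -
        hinner (F₁ z) (F₂ z) * (starRingEnd ℂ) (hinner (F₁ z) (F₂ z))) =
    (1 + (Complex.normSq z : ℂ)) ^ d

def CondB {n : ℕ} (d : ℕ) (c : ℝ) (F₁ F₂ : ℂ → Fin n → ℂ) : Prop :=
  ∀ z : ℂ,
    gram ![vOne F₁ z, vTwo F₂ z, deriv (vOne F₁) z, deriv (vTwo F₂) z] =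
      (c : ℂ) * (1 + (Complex.normSq z : ℂ)) ^ (2 * d - 4)

noncomputable def F1t (t : ℝ) (z : ℂ) : Fin 4 → ℂ :=
  ![(|t - 2| : ℝ) * z ^ 3, (Real.sqrt t : ℝ) * z,
    ((Real.sqrt ((3 - t) / (4 - t)) * |t - 2| : ℝ)) * z ^ 2,
    ((Real.sqrt (t / (4 - t)) : ℝ)) * z ^ 2]

noncomputable def F2t (t : ℝ) (z : ℂ) : Fin 4 → ℂ :=
  ![(Real.sqrt (3 - t) : ℝ) * z ^ 2, 0, (Real.sqrt (4 - t) : ℝ) * z, 0]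

noncomputable def v1t (t : ℝ) (z : ℂ) : Fin 6 → ℂ := vOne (F1t t) z

noncomputable def v2t (t : ℝ) (z : ℂ) : Fin 6 → ℂ := vTwo (F2t t) z


theorem hi_add_left {m : ℕ} (u v w : Fin m → ℂ) : hinner (u + v) w = hinner u w + hinner v w := by
  simp [hinner, add_mul, Finset.sum_add_distrib]

theorem hi_add_right {m : ℕ} (u v w : Fin m → ℂ) : hinner u (v + w) = hinner u v + hinner u w := by
  simp [hinner, mul_add, Finset.sum_add_distrib]

theorem hi_smul_left {m : ℕ} (k : ℂ) (u w : Fin m → ℂ) : hinner (k • u) w = k * hinner u w := by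
  simp [hinner, Finset.mul_sum, mul_assoc]

theorem hi_smul_right {m : ℕ} (k : ℂ) (u w : Fin m → ℂ) :
    hinner u (k • w) = (starRingEnd ℂ) k * hinner u w := by
  simp [hinner, Finset.mul_sum, mul_left_comm]

theorem hi_zero_left {m : ℕ} (w : Fin m → ℂ) : hinner 0 w = 0 := by simp [hinner]

theorem hi_zero_right {m : ℕ} (w : Fin m → ℂ) : hinner w 0 = 0 := by simp [hinner]

theorem hi_conj {m : ℕ} (u w : Fin m → ℂ) : (starRingEnd ℂ) (hinner u w) = hinner w u := by
  simp [hinner, mul_comm]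

theorem hi_self {m : ℕ} (u : Fin m → ℂ) :
    ∃ x : ℝ, 0 ≤ x ∧ hinner u u = (x : ℂ) ∧ (x = 0 → u = 0) := by
  refine ⟨∑ i, Complex.normSq (u i), Finset.sum_nonneg fun i _ => Complex.normSq_nonneg _, ?_, ?_⟩
  · simp [hinner, Complex.mul_conj]
  · intro h
    rw [Finset.sum_eq_zero_iff_of_nonneg fun i _ => Complex.normSq_nonneg _] at h
    funext i
    simpa using h i (Finset.mem_univ i)

theorem hi_self_zero {m : ℕ} {u : Fin m → ℂ} (h : hinner u u = 0) : u = 0 := by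
  obtain ⟨x, _, h2, h3⟩ := hi_self u
  rw [h] at h2
  exact h3 (by exact_mod_cast h2.symm)

theorem hi_cons {n : ℕ} (x y x' y' : ℂ) (u w : Fin n → ℂ) :
    hinner (Fin.cons x (Fin.cons y u) : Fin (n + 2) → ℂ) (Fin.cons x' (Fin.cons y' w)) =
      x * (starRingEnd ℂ) x' + (y * (starRingEnd ℂ) y' + hinner u w) := by
  simp [hinner, Fin.sum_univ_succ]

/-- dependence from a vanishing 2x2 Gram determinant -/
theorem hi_dep {m : ℕ} {d r : Fin m → ℂ} (hd : d ≠ 0)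
    (h : hinner d d * hinner r r - hinner d r * hinner r d = 0) : ∃ k : ℂ, r = k • d := by
  have hdd : hinner d d ≠ 0 := fun h0 => hd (hi_self_zero h0)
  refine ⟨hinner r d / hinner d d, ?_⟩
  have key : r + (-(hinner r d / hinner d d)) • d = 0 := by
    apply hi_self_zero
    simp only [hi_add_left, hi_add_right, hi_smul_left, hi_smul_right, map_neg, map_div₀, hi_conj]
    field_simp
    linear_combination h
  rw [neg_smul, ← sub_eq_add_neg, sub_eq_zero] at key
  exact key

theorem poly_coeff (N : ℕ) (c : ℕ → ℂ) (h : ∀ z : ℂ, ∑ i ∈ Finset.range N, c i * z ^ i = 0) :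
    ∀ i < N, c i = 0 := by
  intro i hi
  have hp : (∑ j ∈ Finset.range N, Polynomial.C (c j) * Polynomial.X ^ j : Polynomial ℂ) = 0 := by
    apply Polynomial.funext
    intro z
    simpa [Polynomial.eval_finsetSum] using h z
  have := congrArg (fun p => Polynomial.coeff p i) hp
  simpa [Polynomial.finsetSum_coeff, Polynomial.coeff_C_mul, Polynomial.coeff_X_pow, hi] using this

theorem poly8 (c0 c1 c2 c3 c4 c5 c6 c7 c8 : ℂ)
    (h : ∀ z : ℂ, c0 + c1 * z + c2 * z ^ 2 + c3 * z ^ 3 + c4 * z ^ 4 + c5 * z ^ 5 + c6 * z ^ 6 +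
      c7 * z ^ 7 + c8 * z ^ 8 = 0) :
    c0 = 0 ∧ c1 = 0 ∧ c2 = 0 ∧ c3 = 0 ∧ c4 = 0 ∧ c5 = 0 ∧ c6 = 0 ∧ c7 = 0 ∧ c8 = 0 := by
  have := poly_coeff 9 (fun i => [c0, c1, c2, c3, c4, c5, c6, c7, c8].getD i 0) (by
    intro z
    rw [← h z]
    simp [Finset.sum_range_succ])
  exact ⟨this 0 (by norm_num), this 1 (by norm_num), this 2 (by norm_num), this 3 (by norm_num),
    this 4 (by norm_num), this 5 (by norm_num), this 6 (by norm_num), this 7 (by norm_num),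
    this 8 (by norm_num)⟩

theorem lim_coeff (p0 p1 : ℂ) (K : ℂ → ℂ) (hK : Continuous K)
    (h : ∀ z, p0 + p1 * z + z ^ 2 * K z = 0) : p0 = 0 ∧ p1 = 0 := by
  have h0 : p0 = 0 := by simpa using h 0
  refine ⟨h0, ?_⟩
  have h1 : (fun z => p1 + z * K z) = fun _ => 0 := by
    refine Continuous.ext_on (s := {0}ᶜ) (dense_compl_singleton 0) (by fun_prop) (by fun_prop) ?_
    intro z hz
    have hz' : z ≠ 0 := hz
    have := h z
    apply mul_left_cancel₀ hz'
    simp only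
    rw [h0] at this
    linear_combination this
  simpa using congrFun h1 0

theorem entire_zero (g : ℂ → ℂ) (hg : Differentiable ℂ g) (h : ∀ x : ℝ, g x = 0) : ∀ z, g z = 0 := by
  have ha : AnalyticOnNhd ℂ g Set.univ := fun z _ => hg.analyticAt z
  have hf : ∃ᶠ z in nhdsWithin (0 : ℂ) {0}ᶜ, g z = 0 := by
    have ht : Filter.Tendsto (fun x : ℝ => (x : ℂ)) (nhdsWithin 0 {0}ᶜ) (nhdsWithin (0 : ℂ) {0}ᶜ) := by
      apply tendsto_nhdsWithin_of_tendsto_nhds_of_eventually_within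
      · have : Filter.Tendsto (fun x : ℝ => (x : ℂ)) (nhds 0) (nhds ((0 : ℝ) : ℂ)) :=
          Complex.continuous_ofReal.tendsto 0
        rw [Complex.ofReal_zero] at this
        exact this.mono_left nhdsWithin_le_nhds
      · filter_upwards [self_mem_nhdsWithin] with x hx
        simpa using hx
    refine ht.frequently ?_
    exact (Filter.Eventually.of_forall fun x => h x).frequently
  intro z
  exact ha.eqOn_zero_of_preconnected_of_frequently_eq_zero isPreconnected_univ
    (Set.mem_univ 0) hf (Set.mem_univ z)

theorem polarize (f : ℂ → ℂ → ℂ) (hf : Differentiable ℂ (fun p : ℂ × ℂ => f p.1 p.2))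
    (h : ∀ z, f z ((starRingEnd ℂ) z) = 0) : ∀ z w, f z w = 0 := by
  have h1 : ∀ (y : ℝ) (x : ℂ), f (x + y * I) (x - y * I) = 0 := by
    intro y
    apply entire_zero (fun x : ℂ => f (x + y * I) (x - y * I))
    · exact hf.comp (f := fun x : ℂ => (x + y * I, x - y * I)) (by fun_prop)
    · intro x
      have := h (x + y * I)
      simpa [sub_eq_add_neg] using this
  have h2 : ∀ (x : ℂ) (y : ℂ), f (x + y * I) (x - y * I) = 0 := by
    intro x
    apply entire_zero (fun y : ℂ => f (x + y * I) (x - y * I))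
    · exact hf.comp (f := fun y : ℂ => (x + y * I, x - y * I)) (by fun_prop)
    · intro y
      exact h1 y x
  intro z w
  have := h2 ((z + w) / 2) (-I * (z - w) / 2)
  have e1 : (z + w) / 2 + -I * (z - w) / 2 * I = z := by
    linear_combination (-(z - w) / 2) * I_sq
  have e2 : (z + w) / 2 - -I * (z - w) / 2 * I = w := by
    linear_combination ((z - w) / 2) * I_sq
  rwa [e1, e2] at this

noncomputable def ff {n : ℕ} (a b c d : Fin n → ℂ) (z : ℂ) : Fin n → ℂ :=
  z • a + z ^ 2 • b + z ^ 3 • c + z ^ 4 • d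

noncomputable def gg {n : ℕ} (a b c d : Fin n → ℂ) (z : ℂ) : Fin n → ℂ :=
  a + (2 * z) • b + (3 * z ^ 2) • c + (4 * z ^ 3) • d

def PolA {n : ℕ} (F₁ F₂ : ℂ → Fin n → ℂ) : Prop :=
  ∀ z w : ℂ,
    1 + hinner (F₁ z) (F₁ ((starRingEnd ℂ) w)) + hinner (F₂ z) (F₂ ((starRingEnd ℂ) w)) +
      (hinner (F₁ z) (F₁ ((starRingEnd ℂ) w)) * hinner (F₂ z) (F₂ ((starRingEnd ℂ) w)) -
        hinner (F₁ z) (F₂ ((starRingEnd ℂ) w)) * hinner (F₂ z) (F₁ ((starRingEnd ℂ) w))) =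
    (1 + z * w) ^ 4

noncomputable def MB {n : ℕ} (x1 x2 y1 y2 u1 u2 v1 v2 : Fin n → ℂ) : Matrix (Fin 4) (Fin 4) ℂ :=
  !![1 + hinner x1 u1, hinner x1 u2, hinner x1 v1, hinner x1 v2;
     hinner x2 u1, 1 + hinner x2 u2, hinner x2 v1, hinner x2 v2;
     hinner y1 u1, hinner y1 u2, hinner y1 v1, hinner y1 v2;
     hinner y2 u1, hinner y2 u2, hinner y2 v1, hinner y2 v2]

def PolB {n : ℕ} (k : ℂ) (F₁ F₂ G₁ G₂ : ℂ → Fin n → ℂ) : Prop :=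
  ∀ z w : ℂ,
    (MB (F₁ z) (F₂ z) (G₁ z) (G₂ z) (F₁ ((starRingEnd ℂ) w)) (F₂ ((starRingEnd ℂ) w))
      (G₁ ((starRingEnd ℂ) w)) (G₂ ((starRingEnd ℂ) w))).det = k * (1 + z * w) ^ 4

theorem det4 (m : Matrix (Fin 4) (Fin 4) ℂ) : m.det =
    m 0 0 * (m 1 1 * (m 2 2 * m 3 3 - m 2 3 * m 3 2) - m 1 2 * (m 2 1 * m 3 3 - m 2 3 * m 3 1) +
      m 1 3 * (m 2 1 * m 3 2 - m 2 2 * m 3 1)) -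
    m 0 1 * (m 1 0 * (m 2 2 * m 3 3 - m 2 3 * m 3 2) - m 1 2 * (m 2 0 * m 3 3 - m 2 3 * m 3 0) +
      m 1 3 * (m 2 0 * m 3 2 - m 2 2 * m 3 0)) +
    m 0 2 * (m 1 0 * (m 2 1 * m 3 3 - m 2 3 * m 3 1) - m 1 1 * (m 2 0 * m 3 3 - m 2 3 * m 3 0) +
      m 1 3 * (m 2 0 * m 3 1 - m 2 1 * m 3 0)) -
    m 0 3 * (m 1 0 * (m 2 1 * m 3 2 - m 2 2 * m 3 1) - m 1 1 * (m 2 0 * m 3 2 - m 2 2 * m 3 0) +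
      m 1 2 * (m 2 0 * m 3 1 - m 2 1 * m 3 0)) := by
  rw [Matrix.det_succ_row_zero]
  simp only [Fin.sum_univ_four, Matrix.det_fin_three, Matrix.submatrix_apply]
  have s1 : (Fin.succ (0 : Fin 3)) = (1 : Fin 4) := rfl
  have s2 : (Fin.succ (1 : Fin 3)) = (2 : Fin 4) := rfl
  have s3 : (Fin.succ (2 : Fin 3)) = (3 : Fin 4) := rfl
  have a00 : (0 : Fin 4).succAbove (0 : Fin 3) = 1 := rfl
  have a01 : (0 : Fin 4).succAbove (1 : Fin 3) = 2 := rfl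
  have a02 : (0 : Fin 4).succAbove (2 : Fin 3) = 3 := rfl
  have a10 : (1 : Fin 4).succAbove (0 : Fin 3) = 0 := rfl
  have a11 : (1 : Fin 4).succAbove (1 : Fin 3) = 2 := rfl
  have a12 : (1 : Fin 4).succAbove (2 : Fin 3) = 3 := rfl
  have a20 : (2 : Fin 4).succAbove (0 : Fin 3) = 0 := rfl
  have a21 : (2 : Fin 4).succAbove (1 : Fin 3) = 1 := rfl
  have a22 : (2 : Fin 4).succAbove (2 : Fin 3) = 3 := rfl
  have a30 : (3 : Fin 4).succAbove (0 : Fin 3) = 0 := rfl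
  have a31 : (3 : Fin 4).succAbove (1 : Fin 3) = 1 := rfl
  have a32 : (3 : Fin 4).succAbove (2 : Fin 3) = 2 := rfl
  have v2 : ((2 : Fin 4) : ℕ) = 2 := rfl
  have v3 : ((3 : Fin 4) : ℕ) = 3 := rfl
  rw [s1, s2, s3, a00, a01, a02, a10, a11, a12, a20, a21, a22, a30, a31, a32, v2, v3]
  simp only [Fin.val_zero, Fin.val_one]
  ring

theorem hi_diff {n : ℕ} (F G : ℂ → Fin n → ℂ)
    (hF : ∀ i, Differentiable ℂ fun z => F z i)
    (hG : ∀ i, Differentiable ℂ fun z => (starRingEnd ℂ) (G ((starRingEnd ℂ) z) i)) :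
    Differentiable ℂ (fun p : ℂ × ℂ => hinner (F p.1) (G ((starRingEnd ℂ) p.2))) := by
  unfold hinner
  apply Differentiable.fun_sum
  intro i _
  apply Differentiable.mul
  · exact (hF i).comp differentiable_fst
  · exact (hG i).comp differentiable_snd

theorem ff_d1 {n : ℕ} (a b c d : Fin n → ℂ) (i) : Differentiable ℂ fun z => ff a b c d z i := by
  simp only [ff, Pi.add_apply, Pi.smul_apply, smul_eq_mul]
  fun_prop

theorem gg_d1 {n : ℕ} (a b c d : Fin n → ℂ) (i) : Differentiable ℂ fun z => gg a b c d z i := by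
  simp only [gg, Pi.add_apply, Pi.smul_apply, smul_eq_mul]
  fun_prop

theorem ff_d2 {n : ℕ} (a b c d : Fin n → ℂ) (i) : Differentiable ℂ fun z =>
    (starRingEnd ℂ) (ff a b c d ((starRingEnd ℂ) z) i) := by
  simp only [ff, Pi.add_apply, Pi.smul_apply, smul_eq_mul, map_add, map_mul, map_pow,
    Complex.conj_conj]
  fun_prop

theorem gg_d2 {n : ℕ} (a b c d : Fin n → ℂ) (i) : Differentiable ℂ fun z =>
    (starRingEnd ℂ) (gg a b c d ((starRingEnd ℂ) z) i) := by
  simp only [gg, Pi.add_apply, Pi.smul_apply, smul_eq_mul, map_add, map_mul, map_pow,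
    Complex.conj_conj]
  fun_prop

theorem ff_hasDeriv {n : ℕ} (a b c d : Fin n → ℂ) (z : ℂ) (i) :
    HasDerivAt (fun z => ff a b c d z i) (gg a b c d z i) z := by
  simp only [ff, gg, Pi.add_apply, Pi.smul_apply, smul_eq_mul]
  have h1 := (hasDerivAt_id z).mul_const (a i)
  have h2 := (hasDerivAt_pow 2 z).mul_const (b i)
  have h3 := (hasDerivAt_pow 3 z).mul_const (c i)
  have h4 := (hasDerivAt_pow 4 z).mul_const (d i)
  refine (((h1.add h2).add h3).add h4).congr_deriv ?_
  simp

theorem deriv_vOne {n : ℕ} (a b c d : Fin n → ℂ) (z : ℂ) :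
    deriv (vOne (ff a b c d)) z = Fin.cons 0 (Fin.cons 0 (gg a b c d z)) := by
  apply HasDerivAt.deriv
  rw [hasDerivAt_pi]
  intro i
  refine Fin.cases ?_ (fun i => Fin.cases ?_ (fun i => ?_) i) i
  · simpa [vOne] using hasDerivAt_const z (1 : ℂ)
  · simpa [vOne] using hasDerivAt_const z (0 : ℂ)
  · simpa [vOne] using ff_hasDeriv a b c d z i

theorem deriv_vTwo {n : ℕ} (a b c d : Fin n → ℂ) (z : ℂ) :
    deriv (vTwo (ff a b c d)) z = Fin.cons 0 (Fin.cons 0 (gg a b c d z)) := by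
  apply HasDerivAt.deriv
  rw [hasDerivAt_pi]
  intro i
  refine Fin.cases ?_ (fun i => Fin.cases ?_ (fun i => ?_) i) i
  · simpa [vTwo] using hasDerivAt_const z (0 : ℂ)
  · simpa [vTwo] using hasDerivAt_const z (1 : ℂ)
  · simpa [vTwo] using ff_hasDeriv a b c d z i

theorem polA_of {n : ℕ} (a b c d p q r s : Fin n → ℂ)
    (h : CondA 4 (ff a b c d) (ff p q r s)) : PolA (ff a b c d) (ff p q r s) := by
  intro z w
  have H : ∀ a b c d p q r s : Fin n → ℂ, Differentiable ℂ (fun x : ℂ × ℂ =>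
      hinner (ff a b c d x.1) (ff p q r s ((starRingEnd ℂ) x.2))) := fun a b c d p q r s =>
    hi_diff _ _ (ff_d1 _ _ _ _) (ff_d2 _ _ _ _)
  have := polarize (fun z w => 1 + hinner (ff a b c d z) (ff a b c d ((starRingEnd ℂ) w)) +
      hinner (ff p q r s z) (ff p q r s ((starRingEnd ℂ) w)) +
      (hinner (ff a b c d z) (ff a b c d ((starRingEnd ℂ) w)) *
        hinner (ff p q r s z) (ff p q r s ((starRingEnd ℂ) w)) -
        hinner (ff a b c d z) (ff p q r s ((starRingEnd ℂ) w)) *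
        hinner (ff p q r s z) (ff a b c d ((starRingEnd ℂ) w))) -
    (1 + z * w) ^ 4) (by
      have h1 := H a b c d a b c d
      have h2 := H a b c d p q r s
      have h3 := H p q r s a b c d
      have h4 := H p q r s p q r s
      fun_prop) (by
      intro z
      have := h z
      rw [hi_conj, ← Complex.mul_conj] at this
      simp only [Complex.conj_conj]
      linear_combination this) z w
  linear_combination this

theorem MB_diff {n : ℕ} (F₁ F₂ G₁ G₂ : ℂ → Fin n → ℂ)
    (h1 : ∀ i, Differentiable ℂ fun z => F₁ z i)
    (h2 : ∀ i, Differentiable ℂ fun z => F₂ z i)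
    (h3 : ∀ i, Differentiable ℂ fun z => G₁ z i)
    (h4 : ∀ i, Differentiable ℂ fun z => G₂ z i)
    (k1 : ∀ i, Differentiable ℂ fun z => (starRingEnd ℂ) (F₁ ((starRingEnd ℂ) z) i))
    (k2 : ∀ i, Differentiable ℂ fun z => (starRingEnd ℂ) (F₂ ((starRingEnd ℂ) z) i))
    (k3 : ∀ i, Differentiable ℂ fun z => (starRingEnd ℂ) (G₁ ((starRingEnd ℂ) z) i))
    (k4 : ∀ i, Differentiable ℂ fun z => (starRingEnd ℂ) (G₂ ((starRingEnd ℂ) z) i)) :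
    Differentiable ℂ (fun p : ℂ × ℂ => (MB (F₁ p.1) (F₂ p.1) (G₁ p.1) (G₂ p.1)
      (F₁ ((starRingEnd ℂ) p.2)) (F₂ ((starRingEnd ℂ) p.2))
      (G₁ ((starRingEnd ℂ) p.2)) (G₂ ((starRingEnd ℂ) p.2))).det) := by
  have d11 := hi_diff F₁ F₁ h1 k1
  have d12 := hi_diff F₁ F₂ h1 k2
  have d13 := hi_diff F₁ G₁ h1 k3
  have d14 := hi_diff F₁ G₂ h1 k4
  have d21 := hi_diff F₂ F₁ h2 k1
  have d22 := hi_diff F₂ F₂ h2 k2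
  have d23 := hi_diff F₂ G₁ h2 k3
  have d24 := hi_diff F₂ G₂ h2 k4
  have d31 := hi_diff G₁ F₁ h3 k1
  have d32 := hi_diff G₁ F₂ h3 k2
  have d33 := hi_diff G₁ G₁ h3 k3
  have d34 := hi_diff G₁ G₂ h3 k4
  have d41 := hi_diff G₂ F₁ h4 k1
  have d42 := hi_diff G₂ F₂ h4 k2
  have d43 := hi_diff G₂ G₁ h4 k3
  have d44 := hi_diff G₂ G₂ h4 k4
  simp only [det4, MB, Matrix.of_apply, Matrix.cons_val', Matrix.cons_val_zero,
            Matrix.cons_val_one, Matrix.cons_val]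
  fun_prop

theorem polB_of {n : ℕ} (k : ℝ) (a b c d p q r s : Fin n → ℂ)
    (h : CondB 4 k (ff a b c d) (ff p q r s)) :
    PolB k (ff a b c d) (ff p q r s) (gg a b c d) (gg p q r s) := by
  intro z w
  have := polarize (fun z w => (MB (ff a b c d z) (ff p q r s z) (gg a b c d z) (gg p q r s z)
      (ff a b c d ((starRingEnd ℂ) w)) (ff p q r s ((starRingEnd ℂ) w))
      (gg a b c d ((starRingEnd ℂ) w)) (gg p q r s ((starRingEnd ℂ) w))).det
      - k * (1 + z * w) ^ 4) (by
      apply Differentiable.sub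
      · exact MB_diff _ _ _ _ (ff_d1 _ _ _ _) (ff_d1 _ _ _ _) (gg_d1 _ _ _ _) (gg_d1 _ _ _ _)
          (ff_d2 _ _ _ _) (ff_d2 _ _ _ _) (gg_d2 _ _ _ _) (gg_d2 _ _ _ _)
      · fun_prop) (by
      intro z
      have := h z
      rw [← Complex.mul_conj, deriv_vOne, deriv_vTwo] at this
      simp only [Complex.conj_conj]
      rw [sub_eq_zero]
      refine Eq.trans ?_ this
      rw [gram]
      congr 1
      ext i j
      fin_cases i <;> fin_cases j <;> simp [MB, vOne, vTwo, hi_cons]) z w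
  linear_combination this

noncomputable def wd {n : ℕ} (x y u v : Fin n → ℂ) : ℂ :=
  hinner x u * hinner y v - hinner x v * hinner y u

theorem ff_left {n : ℕ} (a b c d x : Fin n → ℂ) (z : ℂ) : hinner (ff a b c d z) x =
    z * hinner a x + z ^ 2 * hinner b x + z ^ 3 * hinner c x + z ^ 4 * hinner d x := by
  simp only [ff, hi_add_left, hi_smul_left]

theorem gg_left {n : ℕ} (a b c d x : Fin n → ℂ) (z : ℂ) : hinner (gg a b c d z) x =
    hinner a x + 2 * z * hinner b x + 3 * z ^ 2 * hinner c x + 4 * z ^ 3 * hinner d x := by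
  simp only [gg, hi_add_left, hi_smul_left]

theorem ff_right {n : ℕ} (a b c d x : Fin n → ℂ) (z : ℂ) :
    hinner x (ff a b c d ((starRingEnd ℂ) z)) =
    z * hinner x a + z ^ 2 * hinner x b + z ^ 3 * hinner x c + z ^ 4 * hinner x d := by
  simp only [ff, hi_add_right, hi_smul_right, map_pow, Complex.conj_conj]

theorem gg_right {n : ℕ} (a b c d x : Fin n → ℂ) (z : ℂ) :
    hinner x (gg a b c d ((starRingEnd ℂ) z)) =
    hinner x a + 2 * z * hinner x b + 3 * z ^ 2 * hinner x c + 4 * z ^ 3 * hinner x d := by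
  simp only [gg, hi_add_right, hi_smul_right, map_pow, map_mul, map_ofNat, Complex.conj_conj]

theorem coefA {n : ℕ} (a b c d p q r s : Fin n → ℂ) (h : PolA (ff a b c d) (ff p q r s))
    (w : ℂ) (X Y : Fin n → ℂ) (hX : X = ff a b c d ((starRingEnd ℂ) w))
    (hY : Y = ff p q r s ((starRingEnd ℂ) w)) :
    hinner a X + hinner p Y = 4 * w ∧
    hinner b X + hinner q Y + wd a p X Y = 6 * w ^ 2 ∧
    hinner c X + hinner r Y + wd a q X Y + wd b p X Y = 4 * w ^ 3 ∧
    hinner d X + hinner s Y + wd a r X Y + wd b q X Y + wd c p X Y = w ^ 4 ∧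
    wd a s X Y + wd b r X Y + wd c q X Y + wd d p X Y = 0 ∧
    wd b s X Y + wd c r X Y + wd d q X Y = 0 ∧
    wd c s X Y + wd d r X Y = 0 ∧
    wd d s X Y = 0 := by
  have := poly8 0 (hinner a X + hinner p Y - 4 * w)
    (hinner b X + hinner q Y + wd a p X Y - 6 * w ^ 2)
    (hinner c X + hinner r Y + wd a q X Y + wd b p X Y - 4 * w ^ 3)
    (hinner d X + hinner s Y + wd a r X Y + wd b q X Y + wd c p X Y - w ^ 4)
    (wd a s X Y + wd b r X Y + wd c q X Y + wd d p X Y)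
    (wd b s X Y + wd c r X Y + wd d q X Y)
    (wd c s X Y + wd d r X Y)
    (wd d s X Y) (by
      intro z
      have := h z w
      rw [← hX, ← hY] at this
      simp only [ff_left] at this
      simp only [wd]
      linear_combination this)
  simpa [sub_eq_zero] using this

theorem coefB {n : ℕ} (a b c d p q r s : Fin n → ℂ) (k : ℂ)
    (h : PolB k (ff a b c d) (ff p q r s) (gg a b c d) (gg p q r s))
    (w : ℂ) (U V : Fin n → ℂ) (hU : U = gg a b c d ((starRingEnd ℂ) w))
    (hV : V = gg p q r s ((starRingEnd ℂ) w)) :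
    wd a p U V = k ∧ 2 * (wd a q U V + wd b p U V) = 4 * k * w := by
  obtain ⟨X, hX⟩ : ∃ X, X = ff a b c d ((starRingEnd ℂ) w) := ⟨_, rfl⟩
  obtain ⟨Y, hY⟩ : ∃ X, X = ff p q r s ((starRingEnd ℂ) w) := ⟨_, rfl⟩
  have hc1 : ∀ x, Continuous fun z => hinner (gg a b c d z) x := by
    intro x; simp only [gg_left]; fun_prop
  have hc2 : ∀ x, Continuous fun z => hinner (gg p q r s z) x := by
    intro x; simp only [gg_left]; fun_prop
  have := lim_coeff (wd a p U V - k) (2 * (wd a q U V + wd b p U V) - 4 * k * w)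
    (fun z => 4 * wd b q U V
      + (hinner (gg a b c d z) U * (3 * hinner r V + 4 * z * hinner s V)
        - hinner (gg a b c d z) V * (3 * hinner r U + 4 * z * hinner s U))
      + ((3 * hinner c U + 4 * z * hinner d U) * (hinner p V + 2 * z * hinner q V)
        - (3 * hinner c V + 4 * z * hinner d V) * (hinner p U + 2 * z * hinner q U))
      - k * (6 * w ^ 2 + 4 * z * w ^ 3 + z ^ 2 * w ^ 4)
      + ((-(hinner b X + 2 * z * hinner c X + 3 * z ^ 2 * hinner d X)) *
          (hinner (gg a b c d z) U * hinner (gg p q r s z) V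
            - hinner (gg a b c d z) V * hinner (gg p q r s z) U)
        + (hinner b U + 2 * z * hinner c U + 3 * z ^ 2 * hinner d U) *
          (hinner (gg a b c d z) X * hinner (gg p q r s z) V
            - hinner (gg a b c d z) V * hinner (gg p q r s z) X)
        - (hinner b V + 2 * z * hinner c V + 3 * z ^ 2 * hinner d V) *
          (hinner (gg a b c d z) X * hinner (gg p q r s z) U
            - hinner (gg a b c d z) U * hinner (gg p q r s z) X))
      + ((-(hinner q Y + 2 * z * hinner r Y + 3 * z ^ 2 * hinner s Y)) *
          (hinner (gg a b c d z) U * hinner (gg p q r s z) V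
            - hinner (gg a b c d z) V * hinner (gg p q r s z) U)
        + (hinner q U + 2 * z * hinner r U + 3 * z ^ 2 * hinner s U) *
          (hinner (gg a b c d z) Y * hinner (gg p q r s z) V
            - hinner (gg a b c d z) V * hinner (gg p q r s z) Y)
        - (hinner q V + 2 * z * hinner r V + 3 * z ^ 2 * hinner s V) *
          (hinner (gg a b c d z) Y * hinner (gg p q r s z) U
            - hinner (gg a b c d z) U * hinner (gg p q r s z) Y))
      + z ^ 2 * (!![
          hinner b X + 2 * z * hinner c X + 3 * z ^ 2 * hinner d X,
          hinner b Y + 2 * z * hinner c Y + 3 * z ^ 2 * hinner d Y,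
          hinner b U + 2 * z * hinner c U + 3 * z ^ 2 * hinner d U,
          hinner b V + 2 * z * hinner c V + 3 * z ^ 2 * hinner d V;
          hinner q X + 2 * z * hinner r X + 3 * z ^ 2 * hinner s X,
          hinner q Y + 2 * z * hinner r Y + 3 * z ^ 2 * hinner s Y,
          hinner q U + 2 * z * hinner r U + 3 * z ^ 2 * hinner s U,
          hinner q V + 2 * z * hinner r V + 3 * z ^ 2 * hinner s V;
          hinner (gg a b c d z) X, hinner (gg a b c d z) Y,
          hinner (gg a b c d z) U, hinner (gg a b c d z) V;
          hinner (gg p q r s z) X, hinner (gg p q r s z) Y,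
          hinner (gg p q r s z) U, hinner (gg p q r s z) V] : Matrix (Fin 4) (Fin 4) ℂ).det)
    (by
      have c1 := hc1 X
      have c2 := hc1 Y
      have c3 := hc1 U
      have c4 := hc1 V
      have c5 := hc2 X
      have c6 := hc2 Y
      have c7 := hc2 U
      have c8 := hc2 V
      simp only [det4, Matrix.of_apply, Matrix.cons_val', Matrix.cons_val_zero,
            Matrix.cons_val_one, Matrix.cons_val]
      fun_prop) (by
      intro z
      have := h z w
      rw [← hX, ← hY, ← hU, ← hV] at this
      simp only [det4, MB, Matrix.of_apply, Matrix.cons_val', Matrix.cons_val_zero,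
            Matrix.cons_val_one, Matrix.cons_val] at this ⊢
      have f1 : ∀ x, hinner (ff a b c d z) x = z * hinner (gg a b c d z) x
          - z ^ 2 * (hinner b x + 2 * z * hinner c x + 3 * z ^ 2 * hinner d x) := by
        intro x; rw [ff_left, gg_left]; ring
      have f2 : ∀ x, hinner (ff p q r s z) x = z * hinner (gg p q r s z) x
          - z ^ 2 * (hinner q x + 2 * z * hinner r x + 3 * z ^ 2 * hinner s x) := by
        intro x; rw [ff_left, gg_left]; ring
      simp only [f1, f2] at this
      have e : wd a p U V + 2 * (wd a q U V + wd b p U V) * z + z ^ 2 * (4 * wd b q U V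
        + (hinner (gg a b c d z) U * (3 * hinner r V + 4 * z * hinner s V)
        - hinner (gg a b c d z) V * (3 * hinner r U + 4 * z * hinner s U))
        + ((3 * hinner c U + 4 * z * hinner d U) * (hinner p V + 2 * z * hinner q V)
        - (3 * hinner c V + 4 * z * hinner d V) * (hinner p U + 2 * z * hinner q U)))
          = hinner (gg a b c d z) U * hinner (gg p q r s z) V -
            hinner (gg a b c d z) V * hinner (gg p q r s z) U := by
        simp only [gg_left, wd]; ring
      generalize (hinner b X + 2 * z * hinner c X + 3 * z ^ 2 * hinner d X) = bX at this ⊢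
      generalize (hinner b Y + 2 * z * hinner c Y + 3 * z ^ 2 * hinner d Y) = bY at this ⊢
      generalize (hinner b U + 2 * z * hinner c U + 3 * z ^ 2 * hinner d U) = bU at this ⊢
      generalize (hinner b V + 2 * z * hinner c V + 3 * z ^ 2 * hinner d V) = bV at this ⊢
      generalize (hinner q X + 2 * z * hinner r X + 3 * z ^ 2 * hinner s X) = qX at this ⊢
      generalize (hinner q Y + 2 * z * hinner r Y + 3 * z ^ 2 * hinner s Y) = qY at this ⊢
      generalize (hinner q U + 2 * z * hinner r U + 3 * z ^ 2 * hinner s U) = qU at this ⊢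
      generalize (hinner q V + 2 * z * hinner r V + 3 * z ^ 2 * hinner s V) = qV at this ⊢
      linear_combination this + e)
  exact ⟨sub_eq_zero.1 this.1, sub_eq_zero.1 this.2⟩

theorem wd_ff {n : ℕ} (x y a b c d p q r s : Fin n → ℂ) (w : ℂ) :
    wd x y (ff a b c d ((starRingEnd ℂ) w)) (ff p q r s ((starRingEnd ℂ) w)) =
      wd x y a p * w ^ 2 + (wd x y a q + wd x y b p) * w ^ 3 +
      (wd x y a r + wd x y b q + wd x y c p) * w ^ 4 +
      (wd x y a s + wd x y b r + wd x y c q + wd x y d p) * w ^ 5 +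
      (wd x y b s + wd x y c r + wd x y d q) * w ^ 6 +
      (wd x y c s + wd x y d r) * w ^ 7 + wd x y d s * w ^ 8 := by
  simp only [wd, ff_right]; ring

theorem wd_gg {n : ℕ} (x y a b c d p q r s : Fin n → ℂ) (w : ℂ) :
    wd x y (gg a b c d ((starRingEnd ℂ) w)) (gg p q r s ((starRingEnd ℂ) w)) =
      wd x y a p + 2 * (wd x y a q + wd x y b p) * w +
      (3 * wd x y a r + 4 * wd x y b q + 3 * wd x y c p) * w ^ 2 +
      (4 * wd x y a s + 6 * wd x y b r + 6 * wd x y c q + 4 * wd x y d p) * w ^ 3 +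
      (8 * wd x y b s + 9 * wd x y c r + 8 * wd x y d q) * w ^ 4 +
      12 * (wd x y c s + wd x y d r) * w ^ 5 + 16 * wd x y d s * w ^ 6 := by
  simp only [wd, gg_right]; ring

theorem rowA1 {n : ℕ} (a b c d p q r s : Fin n → ℂ) (h : PolA (ff a b c d) (ff p q r s)) :
    hinner a a + hinner p p = 4 ∧ hinner a b + hinner p q = 0 ∧
    hinner a c + hinner p r = 0 ∧ hinner a d + hinner p s = 0 := by
  have := poly8 0 (hinner a a + hinner p p - 4) (hinner a b + hinner p q)
    (hinner a c + hinner p r) (hinner a d + hinner p s) 0 0 0 0 (by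
      intro w
      have := (coefA a b c d p q r s h w _ _ rfl rfl).1
      simp only [ff_right] at this
      linear_combination this)
  simpa [sub_eq_zero] using this

theorem rowA2 {n : ℕ} (a b c d p q r s : Fin n → ℂ) (h : PolA (ff a b c d) (ff p q r s)) :
    hinner b b + hinner q q + wd a p a p = 6 ∧
    hinner b c + hinner q r + (wd a p a q + wd a p b p) = 0 ∧
    hinner b d + hinner q s + (wd a p a r + wd a p b q + wd a p c p) = 0 := by
  have := poly8 0 (hinner b a + hinner q p) (hinner b b + hinner q q + wd a p a p - 6)
    (hinner b c + hinner q r + (wd a p a q + wd a p b p))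
    (hinner b d + hinner q s + (wd a p a r + wd a p b q + wd a p c p))
    (wd a p a s + wd a p b r + wd a p c q + wd a p d p)
    (wd a p b s + wd a p c r + wd a p d q)
    (wd a p c s + wd a p d r)
    (wd a p d s) (by
      intro w
      have := (coefA a b c d p q r s h w _ _ rfl rfl).2.1
      simp only [ff_right, wd_ff] at this
      linear_combination this)
  exact ⟨sub_eq_zero.1 this.2.2.1, this.2.2.2.1, this.2.2.2.2.1⟩

theorem rowA3 {n : ℕ} (a b c d p q r s : Fin n → ℂ) (h : PolA (ff a b c d) (ff p q r s)) :
    hinner c c + hinner r r + (wd a q a q + wd b p a q + wd a q b p + wd b p b p) = 4 ∧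
    hinner c d + hinner r s + (wd a q a r + wd a q b q + wd a q c p)
      + (wd b p a r + wd b p b q + wd b p c p) = 0 := by
  have := poly8 0 (hinner c a + hinner r p) (hinner c b + hinner r q + wd a q a p + wd b p a p)
    (hinner c c + hinner r r + (wd a q a q + wd b p a q + wd a q b p + wd b p b p) - 4)
    (hinner c d + hinner r s + (wd a q a r + wd a q b q + wd a q c p)
      + (wd b p a r + wd b p b q + wd b p c p))
    (wd a q a s + wd a q b r + wd a q c q + wd a q d p +
      (wd b p a s + wd b p b r + wd b p c q + wd b p d p))
    (wd a q b s + wd a q c r + wd a q d q + (wd b p b s + wd b p c r + wd b p d q))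
    (wd a q c s + wd a q d r + (wd b p c s + wd b p d r))
    (wd a q d s + wd b p d s) (by
      intro w
      have := (coefA a b c d p q r s h w _ _ rfl rfl).2.2.1
      simp only [ff_right, wd_ff] at this
      linear_combination this)
  exact ⟨sub_eq_zero.1 this.2.2.2.1, this.2.2.2.2.1⟩

theorem rowA4 {n : ℕ} (a b c d p q r s : Fin n → ℂ) (h : PolA (ff a b c d) (ff p q r s)) :
    hinner d d + hinner s s + (wd a r a r + wd a r b q + wd a r c p) +
      (wd b q a r + wd b q b q + wd b q c p) + (wd c p a r + wd c p b q + wd c p c p) = 1 := by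
  have := poly8 0 (hinner d a + hinner s p) (hinner d b + hinner s q + wd a r a p + wd b q a p
      + wd c p a p)
    (hinner d c + hinner s r + (wd a r a q + wd a r b p) + (wd b q a q + wd b q b p)
      + (wd c p a q + wd c p b p))
    (hinner d d + hinner s s + (wd a r a r + wd a r b q + wd a r c p) +
      (wd b q a r + wd b q b q + wd b q c p) + (wd c p a r + wd c p b q + wd c p c p) - 1)
    (wd a r a s + wd a r b r + wd a r c q + wd a r d p +
      (wd b q a s + wd b q b r + wd b q c q + wd b q d p) +
      (wd c p a s + wd c p b r + wd c p c q + wd c p d p))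
    (wd a r b s + wd a r c r + wd a r d q + (wd b q b s + wd b q c r + wd b q d q) +
      (wd c p b s + wd c p c r + wd c p d q))
    (wd a r c s + wd a r d r + (wd b q c s + wd b q d r) + (wd c p c s + wd c p d r))
    (wd a r d s + wd b q d s + wd c p d s) (by
      intro w
      have := (coefA a b c d p q r s h w _ _ rfl rfl).2.2.2.1
      simp only [ff_right, wd_ff] at this
      linear_combination this)
  exact sub_eq_zero.1 this.2.2.2.2.1

theorem rowA8 {n : ℕ} (a b c d p q r s : Fin n → ℂ) (h : PolA (ff a b c d) (ff p q r s)) :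
    wd d s d s = 0 := by
  have := poly8 0 0 (wd d s a p) (wd d s a q + wd d s b p)
    (wd d s a r + wd d s b q + wd d s c p)
    (wd d s a s + wd d s b r + wd d s c q + wd d s d p)
    (wd d s b s + wd d s c r + wd d s d q)
    (wd d s c s + wd d s d r)
    (wd d s d s) (by
      intro w
      have := (coefA a b c d p q r s h w _ _ rfl rfl).2.2.2.2.2.2.2
      simp only [wd_ff] at this
      linear_combination this)
  exact this.2.2.2.2.2.2.2.2

theorem wd_zero2 {n : ℕ} (x u v : Fin n → ℂ) : wd x 0 u v = 0 := by
  simp [wd, hi_zero_left]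

theorem wd_zero4 {n : ℕ} (x y u : Fin n → ℂ) : wd x y u 0 = 0 := by
  simp [wd, hi_zero_right]

theorem rowA7 {n : ℕ} (a b c d p q r : Fin n → ℂ) (h : PolA (ff a b c d) (ff p q r 0)) :
    wd d r d r = 0 := by
  have := poly8 0 0 (wd d r a p) (wd d r a q + wd d r b p)
    (wd d r a r + wd d r b q + wd d r c p)
    (wd d r b r + wd d r c q + wd d r d p)
    (wd d r c r + wd d r d q)
    (wd d r d r)
    0 (by
      intro w
      have := (coefA a b c d p q r 0 h w _ _ rfl rfl).2.2.2.2.2.2.1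
      simp only [wd_ff, wd_zero2, wd_zero4] at this
      linear_combination this)
  exact this.2.2.2.2.2.2.2.1

theorem rowA6 {n : ℕ} (a b c d p q r : Fin n → ℂ) (h : PolA (ff a b c d) (ff p q r 0)) :
    wd c r c r + wd c r d q + (wd d q c r + wd d q d q) = 0 := by
  have := poly8 0 0 (wd c r a p + wd d q a p) (wd c r a q + wd c r b p + (wd d q a q + wd d q b p))
    (wd c r a r + wd c r b q + wd c r c p + (wd d q a r + wd d q b q + wd d q c p))
    (wd c r b r + wd c r c q + wd c r d p + (wd d q b r + wd d q c q + wd d q d p))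
    (wd c r c r + wd c r d q + (wd d q c r + wd d q d q))
    (wd c r d r + wd d q d r)
    0 (by
      intro w
      have := (coefA a b c d p q r 0 h w _ _ rfl rfl).2.2.2.2.2.1
      simp only [wd_ff, wd_zero2, wd_zero4] at this
      linear_combination this)
  exact this.2.2.2.2.2.2.1

theorem rowA5 {n : ℕ} (a b c d p q r : Fin n → ℂ) (h : PolA (ff a b c d) (ff p q r 0)) :
    wd b r b r + wd b r c q + wd b r d p + (wd c q b r + wd c q c q + wd c q d p) +
      (wd d p b r + wd d p c q + wd d p d p) = 0 := by
  have := poly8 0 0 (wd b r a p + wd c q a p + wd d p a p)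
    (wd b r a q + wd b r b p + (wd c q a q + wd c q b p) + (wd d p a q + wd d p b p))
    (wd b r a r + wd b r b q + wd b r c p + (wd c q a r + wd c q b q + wd c q c p) +
      (wd d p a r + wd d p b q + wd d p c p))
    (wd b r b r + wd b r c q + wd b r d p + (wd c q b r + wd c q c q + wd c q d p) +
      (wd d p b r + wd d p c q + wd d p d p))
    (wd b r c r + wd b r d q + (wd c q c r + wd c q d q) + (wd d p c r + wd d p d q))
    (wd b r d r + wd c q d r + wd d p d r)
    0 (by
      intro w
      have := (coefA a b c d p q r 0 h w _ _ rfl rfl).2.2.2.2.1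
      simp only [wd_ff, wd_zero2, wd_zero4] at this
      linear_combination this)
  exact this.2.2.2.2.2.1

theorem rowB {n : ℕ} (a b c d p q r s : Fin n → ℂ) (k : ℂ)
    (h : PolB k (ff a b c d) (ff p q r s) (gg a b c d) (gg p q r s)) :
    wd a p a p = k ∧ wd a p a q + wd a p b p = 0 ∧
    3 * wd a p a r + 4 * wd a p b q + 3 * wd a p c p = 0 ∧
    8 * wd a p b s + 9 * wd a p c r + 8 * wd a p d q = 0 ∧
    wd a q a q + wd b p a q + wd a q b p + wd b p b p = k ∧
    3 * wd a q a r + 4 * wd a q b q + 3 * wd a q c p +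
      (3 * wd b p a r + 4 * wd b p b q + 3 * wd b p c p) = 0 := by
  have h1 := poly8 (wd a p a p - k) (2 * (wd a p a q + wd a p b p))
    (3 * wd a p a r + 4 * wd a p b q + 3 * wd a p c p)
    (4 * wd a p a s + 6 * wd a p b r + 6 * wd a p c q + 4 * wd a p d p)
    (8 * wd a p b s + 9 * wd a p c r + 8 * wd a p d q)
    (12 * (wd a p c s + wd a p d r)) (16 * wd a p d s) 0 0 (by
      intro w
      have := (coefB a b c d p q r s k h w _ _ rfl rfl).1
      simp only [wd_gg] at this
      linear_combination this)
  have h2 := poly8 (wd a q a p + wd b p a p)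
    (2 * (wd a q a q + wd b p a q + wd a q b p + wd b p b p) - 2 * k)
    (3 * wd a q a r + 4 * wd a q b q + 3 * wd a q c p +
      (3 * wd b p a r + 4 * wd b p b q + 3 * wd b p c p))
    (4 * wd a q a s + 6 * wd a q b r + 6 * wd a q c q + 4 * wd a q d p +
      (4 * wd b p a s + 6 * wd b p b r + 6 * wd b p c q + 4 * wd b p d p))
    (8 * wd a q b s + 9 * wd a q c r + 8 * wd a q d q +
      (8 * wd b p b s + 9 * wd b p c r + 8 * wd b p d q))
    (12 * (wd a q c s + wd a q d r) + 12 * (wd b p c s + wd b p d r))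
    (16 * wd a q d s + 16 * wd b p d s) 0 0 (by
      intro w
      have := (coefB a b c d p q r s k h w _ _ rfl rfl).2
      simp only [wd_gg] at this
      linear_combination this / 2)
  refine ⟨sub_eq_zero.1 h1.1, ?_, h1.2.2.1, h1.2.2.2.2.1, ?_, h2.2.2.1⟩
  · linear_combination h1.2.1 / 2
  · linear_combination h2.2.1 / 2

/-- parametrisation -/
theorem param {n : ℕ} (a b c d p q r : Fin n → ℂ) (h : PolA (ff a b c d) (ff p q r 0))
    (hd : d ≠ 0) : ∃ l m v : ℂ, r = l • d ∧ q = l • c + m • d ∧ p = l • b + m • c + v • d := by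
  obtain ⟨l, hl⟩ := hi_dep hd (rowA7 a b c d p q r h)
  have h6 := rowA6 a b c d p q r h
  have h5 := rowA5 a b c d p q r h
  subst hl
  have : ∃ m : ℂ, q + (-l) • c = m • d := by
    apply hi_dep hd
    simp only [wd, hi_add_left, hi_add_right, hi_smul_left, hi_smul_right, map_neg] at h6 ⊢
    linear_combination h6
  obtain ⟨m, hm⟩ := this
  have hq : q = l • c + m • d := by rw [← hm]; module
  subst hq
  have : ∃ v : ℂ, p + (-l) • b + (-m) • c = v • d := by
    apply hi_dep hd
    simp only [wd, hi_add_left, hi_add_right, hi_smul_left, hi_smul_right, map_neg] at h5 ⊢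
    linear_combination h5
  obtain ⟨v, hv⟩ := this
  exact ⟨l, m, v, rfl, rfl, by rw [← hv]; module⟩

structure Orth {n : ℕ} (a b c d : Fin n → ℂ) (A B C E : ℂ) : Prop where
  aa : hinner a a = A
  bb : hinner b b = B
  cc : hinner c c = C
  dd : hinner d d = E
  ab : hinner a b = 0
  ac : hinner a c = 0
  ad : hinner a d = 0
  ba : hinner b a = 0
  bc : hinner b c = 0
  bd : hinner b d = 0
  ca : hinner c a = 0
  cb : hinner c b = 0
  cd : hinner c d = 0
  da : hinner d a = 0
  db : hinner d b = 0
  dc : hinner d c = 0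

theorem diagB1 {n : ℕ} (a b c d : Fin n → ℂ) (A B C E l k : ℂ) (o : Orth a b c d A B C E)
    (h : PolB k (ff a b c d) (ff (l • b) (l • c) (l • d) 0) (gg a b c d)
      (gg (l • b) (l • c) (l • d) 0)) :
    (l * (starRingEnd ℂ) l) * C * E + (l * (starRingEnd ℂ) l) ^ 2 * A * C * E = k := by
  obtain ⟨aa, bb, cc, dd, ab, ac, ad, ba, bc, bd, ca, cb, cd, da, db, dc⟩ := o
  have := poly8 ((l * (starRingEnd ℂ) l) * A * B - k) (4 * (l * (starRingEnd ℂ) l) * A * C - 4 * k)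
    ((l * (starRingEnd ℂ) l) * (9 * A * E + B * C + (l * (starRingEnd ℂ) l) * A * B * C) - 6 * k)
    (4 * (l * (starRingEnd ℂ) l) * (B * E + (l * (starRingEnd ℂ) l) * A * B * E) - 4 * k)
    ((l * (starRingEnd ℂ) l) * C * E + (l * (starRingEnd ℂ) l) ^ 2 * A * C * E - k) 0 0 0 0 (by
      intro z
      have := h z 1
      simp only [MB, det4, Matrix.of_apply, Matrix.cons_val', Matrix.cons_val_zero,
            Matrix.cons_val_one, Matrix.cons_val, ff_left, gg_left, ff_right, gg_right,
            hi_smul_left, hi_smul_right, hi_zero_left, hi_zero_right,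
            aa, bb, cc, dd, ab, ac, ad, ba, bc, bd, ca, cb, cd, da, db, dc,
            mul_zero, zero_mul, add_zero, zero_add, one_mul, mul_one, one_pow, sub_zero, zero_sub] at this
      generalize (starRingEnd ℂ) l = l' at this ⊢
      linear_combination this)
  exact sub_eq_zero.1 this.2.2.2.2.1

theorem diagB2 {n : ℕ} (a b c d : Fin n → ℂ) (A B C E l k : ℂ) (o : Orth a b c d A B C E)
    (h : PolB k (ff a b c d) (ff (l • d) 0 0 0) (gg a b c d)
      (gg (l • d) 0 0 0)) :
    (l * (starRingEnd ℂ) l) * B * C * E = k := by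
  obtain ⟨aa, bb, cc, dd, ab, ac, ad, ba, bc, bd, ca, cb, cd, da, db, dc⟩ := o
  have := poly8 ((l * (starRingEnd ℂ) l) * A * E - k) (4 * (l * (starRingEnd ℂ) l) * B * E - 4 * k)
    ((l * (starRingEnd ℂ) l) * (9 * C * E + A * B * E) - 6 * k)
    (4 * (l * (starRingEnd ℂ) l) * A * C * E - 4 * k)
    ((l * (starRingEnd ℂ) l) * B * C * E - k) 0 0 0 0 (by
      intro z
      have := h z 1
      simp only [MB, det4, Matrix.of_apply, Matrix.cons_val', Matrix.cons_val_zero,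
            Matrix.cons_val_one, Matrix.cons_val, ff_left, gg_left, ff_right, gg_right,
            hi_smul_left, hi_smul_right, hi_zero_left, hi_zero_right,
            aa, bb, cc, dd, ab, ac, ad, ba, bc, bd, ca, cb, cd, da, db, dc,
            mul_zero, zero_mul, add_zero, zero_add, one_mul, mul_one, one_pow, sub_zero, zero_sub] at this
      generalize (starRingEnd ℂ) l = l' at this ⊢
      linear_combination this)
  exact sub_eq_zero.1 this.2.2.2.2.1

theorem diagB3 {n : ℕ} (a b c d : Fin n → ℂ) (A B C E l k : ℂ) (o : Orth a b c d A B C E)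
    (h : PolB k (ff a b c d) (ff (l • c) (l • d) 0 0) (gg a b c d)
      (gg (l • c) (l • d) 0 0)) :
    (l * (starRingEnd ℂ) l) * (16 * B * E + A * B * C + (l * (starRingEnd ℂ) l) * A * C * E)
      = 6 * k ∧
    (l * (starRingEnd ℂ) l) * (C * E + A * B * E + (l * (starRingEnd ℂ) l) * B * C * E) = k := by
  obtain ⟨aa, bb, cc, dd, ab, ac, ad, ba, bc, bd, ca, cb, cd, da, db, dc⟩ := o
  have := poly8 ((l * (starRingEnd ℂ) l) * A * C - k)
    (4 * (l * (starRingEnd ℂ) l) * (A * E + B * C) - 4 * k)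
    ((l * (starRingEnd ℂ) l) * (16 * B * E + A * B * C + (l * (starRingEnd ℂ) l) * A * C * E)
      - 6 * k)
    (4 * ((l * (starRingEnd ℂ) l) * (C * E + A * B * E + (l * (starRingEnd ℂ) l) * B * C * E)) -
      4 * k)
    ((l * (starRingEnd ℂ) l) * A * C * E + (l * (starRingEnd ℂ) l) ^ 2 * A * B * C * E - k)
    0 0 0 0 (by
      intro z
      have := h z 1
      simp only [MB, det4, Matrix.of_apply, Matrix.cons_val', Matrix.cons_val_zero,
            Matrix.cons_val_one, Matrix.cons_val, ff_left, gg_left, ff_right, gg_right,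
            hi_smul_left, hi_smul_right, hi_zero_left, hi_zero_right,
            aa, bb, cc, dd, ab, ac, ad, ba, bc, bd, ca, cb, cd, da, db, dc,
            mul_zero, zero_mul, add_zero, zero_add, one_mul, mul_one, one_pow, sub_zero, zero_sub] at this
      generalize (starRingEnd ℂ) l = l' at this ⊢
      linear_combination this)
  refine ⟨sub_eq_zero.1 this.2.2.1, ?_⟩
  linear_combination this.2.2.2.1 / 4

theorem real1 (A B C E l k : ℝ) (hA : 0 ≤ A) (hB : 0 ≤ B) (hC : 0 ≤ C) (hE : 0 ≤ E) (hl : 0 ≤ l)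
    (hk : 0 < k) (h1 : A + l * B = 4) (h2 : B + l * C + l * A * B = 6)
    (h3 : C + l * E + l * A * C = 4) (h4 : E + l * A * E = 1) (h5 : l * A * B = k)
    (h6 : l * A * C = k) (h7 : l * C * E + l ^ 2 * A * C * E = k) : False := by
  have hA0 : A ≠ 0 := by rintro rfl; linarith
  have hl0 : l ≠ 0 := by rintro rfl; linarith
  have hBC : B = C := by
    have : l * A * (B - C) = 0 := by linear_combination h5 - h6
    simpa [hA0, hl0, sub_eq_zero] using this
  subst hBC
  have hlB : l * B = k := by linear_combination h7 - l * B * h4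
  have hA1 : A = 1 := by
    have : k * (A - 1) = 0 := by linear_combination h5 - A * hlB
    have := (mul_eq_zero.1 this).resolve_left hk.ne'
    linarith
  subst hA1
  have : B = 0 := by linarith
  subst this
  linarith

theorem real2 (A B C E l k : ℝ) (hE0 : E ≠ 0)
    (hk : 0 < k) (h1 : A + l * E = 4) (h2 : B + l * A * E = 6)
    (h3 : C + l * B * E = 4) (h4 : E + l * C * E = 1) (h5 : l * A * E = k)
    (h6 : l * B * E = k) (h7 : l * B * C * E = k) : False := by
  have hC : C = 1 := by
    have : k * (C - 1) = 0 := by linear_combination h7 - C * h6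
    have := (mul_eq_zero.1 this).resolve_left hk.ne'
    linarith
  subst hC
  have hk3 : k = 3 := by linarith
  have hB : B = 3 := by linarith
  have hlE : l * E = 1 := by rw [hB] at h6; linarith
  apply hE0
  linarith

theorem real3 (A B C E l k : ℝ) (hA : 0 ≤ A) (hB : 0 ≤ B) (hC : 0 ≤ C) (hE : 0 ≤ E) (hl : 0 ≤ l)
    (hk : 0 < k) (h1 : A + l * C = 4) (h2 : B + l * E + l * A * C = 6)
    (h3 : C + l * (A * E + B * C) = 4) (h4 : E + l * B * E = 1) (h5 : l * A * C = k)
    (h6 : l * (A * E + B * C) = k)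
    (h7 : l * (16 * B * E + A * B * C + l * A * C * E) = 6 * k)
    (h8 : l * (C * E + A * B * E + l * B * C * E) = k) : False := by
  have hA0 : A ≠ 0 := by rintro rfl; linarith
  have hl0 : l ≠ 0 := by rintro rfl; linarith
  have hC0 : C ≠ 0 := by rintro rfl; linarith
  have hE0 : E ≠ 0 := by rintro rfl; linarith
  have g5 : A * C = A * E + B * C := by
    apply mul_left_cancel₀ hl0; linear_combination h5 - h6
  have g6 : C + A * B * E = A * C := by
    apply mul_left_cancel₀ hl0; linear_combination h8 - h5 - l * C * h4
  have g7 : 16 * B * E + A * B * C + l * A * C * E = 6 * (A * C) := by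
    apply mul_left_cancel₀ hl0; linear_combination h7 - 6 * h5
  have gC : C = (A - 2) ^ 2 := by linear_combination h3 - h6 + h5 - A * h1
  have g : (1 - B) * (1 + B - A) = 0 := by
    apply mul_left_cancel₀ hC0; linear_combination g6 + B * g5
  rcases mul_eq_zero.1 g with g | g
  · have hB1 : B = 1 := by linarith
    subst hB1
    have : l * E = C + 1 := by rw [gC]; linear_combination h2 - A * h1
    have hCp : 0 < C := lt_of_le_of_ne hC (Ne.symm hC0)
    linarith
  · have hB1 : B = A - 1 := by linarith
    subst hB1
    have gE : A * E = C := by linear_combination - g5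
    have : A * (E * ((A - 2) ^ 2 * (A - 4))) = 0 := by
      linear_combination A * g7 - A * (A * E) * h1 - (6 * A ^ 2 - A ^ 2 * (A - 1)) * gE
    rcases mul_eq_zero.1 this with h | h
    · exact hA0 h
    rcases mul_eq_zero.1 h with h | h
    · exact hE0 h
    rcases mul_eq_zero.1 h with h | h
    · exact hC0 (by rw [gC, h])
    · have : l * C = 0 := by linarith
      simp [hl0, hC0] at this

theorem sym0 {n : ℕ} {x y : Fin n → ℂ} (h : hinner x y = 0) : hinner y x = 0 := by
  rw [← hi_conj, h, map_zero]

theorem conj_ne {l : ℂ} (h : l ≠ 0) : (starRingEnd ℂ) l ≠ 0 := by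
  simpa using h

theorem core1 {n : ℕ} (a b c d p q r : Fin n → ℂ) (k : ℝ) (hk : 0 < k)
    (hA : PolA (ff a b c d) (ff p q r 0))
    (hB : PolB (k : ℂ) (ff a b c d) (ff p q r 0) (gg a b c d) (gg p q r 0))
    (hd : d ≠ 0) (l m v : ℂ) (hr : r = l • d) (hq : q = l • c + m • d)
    (hp : p = l • b + m • c + v • d) (hl : l ≠ 0) : False := by
  have hL := conj_ne hl
  have hdd : hinner d d ≠ 0 := fun h => hd (hi_self_zero h)
  have xr : ∀ x, hinner x r = (starRingEnd ℂ) l * hinner x d := by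
    intro x; rw [hr, hi_smul_right]
  have xq : ∀ x, hinner x q = (starRingEnd ℂ) l * hinner x c + (starRingEnd ℂ) m * hinner x d := by
    intro x; rw [hq]; simp only [hi_add_right, hi_smul_right]
  have xp : ∀ x, hinner x p = (starRingEnd ℂ) l * hinner x b + (starRingEnd ℂ) m * hinner x c
      + (starRingEnd ℂ) v * hinner x d := by
    intro x; rw [hp]; simp only [hi_add_right, hi_smul_right]
  have qx : ∀ x, hinner q x = l * hinner c x + m * hinner d x := by
    intro x; rw [hq]; simp only [hi_add_left, hi_smul_left]
  have px : ∀ x, hinner p x = l * hinner b x + m * hinner c x + v * hinner d x := by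
    intro x; rw [hp]; simp only [hi_add_left, hi_smul_left]
  obtain ⟨A11, A12, A13, A14⟩ := rowA1 _ _ _ _ _ _ _ _ hA
  obtain ⟨A21, A22, A23⟩ := rowA2 _ _ _ _ _ _ _ _ hA
  obtain ⟨A31, A32⟩ := rowA3 _ _ _ _ _ _ _ _ hA
  have A4 := rowA4 _ _ _ _ _ _ _ _ hA
  obtain ⟨B1, B2, B3, B4, B5, B6⟩ := rowB _ _ _ _ _ _ _ _ _ hB
  have hkc : (k : ℂ) ≠ 0 := by exact_mod_cast hk.ne'
  have haa : hinner a a ≠ 0 := by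
    intro h
    have := hi_self_zero h
    subst this
    apply hkc
    rw [← B1]
    simp [wd, hi_zero_left]
  simp only [wd, xr, xq, xp, hi_zero_right, hi_zero_left] at A12 A13 A14 A22 A23 A32 B2 B3 B4 B6
  set L := (starRingEnd ℂ) l with hLdef
  set M := (starRingEnd ℂ) m with hMdef
  set V := (starRingEnd ℂ) v with hVdef
  have had : hinner a d = 0 := by linear_combination A14
  simp only [had] at A12 A13 A22 A23 A32 B2 B3 B4 B6
  have hpd : hinner p d = 0 := by
    have : (L * L) * (hinner p d * hinner p d) = 0 := by
      linear_combination L * hinner p d * A13 - B4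
    have := (mul_eq_zero.1 this).resolve_left (mul_ne_zero hL hL)
    exact mul_self_eq_zero.1 this
  have hac : hinner a c = 0 := by linear_combination A13 - L * hpd
  simp only [hpd, hac] at A12 A22 A23 A32 B2 B3 B6
  have hbd : hinner b d = 0 := by linear_combination A23
  simp only [hbd] at A22 A32 B2 B3 B6
  have hpc : hinner p c = 0 := by
    by_contra hne
    have h1 : L * hinner a b * hinner p c = 0 := by linear_combination B3
    have hab : hinner a b = 0 := by simpa [hL, hne] using h1
    rw [hab] at B2
    have h2 : L * hinner a a * hinner p c = 0 := by linear_combination B2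
    simp [hL, hne, haa] at h2
  simp only [hpc] at A12 A22 A32 B2 B3 B6
  have hab : hinner a b = 0 := by linear_combination A12
  simp only [hab] at A22 A32 B2 B3 B6
  have hbc : hinner b c = - L * hinner q d := by linear_combination A22
  have hpp : hinner p p = L * hinner p b := by
    rw [xp, hpc, hpd]; ring
  have hqd : hinner q d = 0 := by
    rw [hpp] at A11
    rw [hbc] at B6
    have h1 : L * ((4 + 2 * hinner a a) * hinner q d) = 0 := by
      linear_combination B6 - L * hinner q d * A11
    have h2 := (mul_eq_zero.1 h1).resolve_left hL
    obtain ⟨x, hx, hx', -⟩ := hi_self a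
    have h3 : (4 + 2 * hinner a a) ≠ 0 := by
      rw [hx']
      have : (4 + 2 * x) ≠ 0 := by positivity
      exact_mod_cast this
    exact (mul_eq_zero.1 h2).resolve_left h3
  rw [hqd, mul_zero] at hbc
  simp only [hqd, hbc] at A32
  have hcd : hinner c d = 0 := by linear_combination A32
  have hm : m = 0 := by
    have := qx d
    rw [hqd, hcd] at this
    have : m * hinner d d = 0 := by linear_combination - this
    exact (mul_eq_zero.1 this).resolve_right hdd
  have hv : v = 0 := by
    have := px d
    rw [hpd, hbd, hcd] at this
    have : v * hinner d d = 0 := by linear_combination - this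
    exact (mul_eq_zero.1 this).resolve_right hdd
  obtain ⟨A, hA0, hAA, -⟩ := hi_self a
  obtain ⟨B, hB0, hBB, -⟩ := hi_self b
  obtain ⟨C, hC0, hCC, -⟩ := hi_self c
  obtain ⟨E, hE0, hEE, -⟩ := hi_self d
  have o : Orth a b c d A B C E := ⟨hAA, hBB, hCC, hEE, hab, hac, had, sym0 hab, hbc, hbd,
    sym0 hac, sym0 hbc, hcd, sym0 had, sym0 hbd, sym0 hcd⟩
  have hp' : p = l • b := by rw [hp, hm, hv]; module
  have hq' : q = l • c := by rw [hq, hm]; module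
  clear xr xq xp qx px hp hq hm hv hpc hpd hqd hpp
  subst hp' hq' hr
  have B7 := diagB1 _ _ _ _ _ _ _ _ _ _ o hB
  obtain ⟨aa, bb, cc, dd, ab, ac, ad, ba, bc, bd, ca, cb, cd, da, db, dc⟩ := o
  simp only [wd, hi_smul_left, hi_smul_right, hi_zero_left, hi_zero_right,
    aa, bb, cc, dd, ab, ac, ad, ba, bc, bd, ca, cb, cd, da, db, dc, mul_zero, zero_mul,
    add_zero, zero_add, sub_zero] at A11 A21 A31 A4 B1 B5
  have hn : l * (starRingEnd ℂ) l = ((Complex.normSq l : ℝ) : ℂ) := Complex.mul_conj l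
  refine real1 A B C E (Complex.normSq l) k hA0 hB0 hC0 hE0 (Complex.normSq_nonneg _) hk
    ?_ ?_ ?_ ?_ ?_ ?_ ?_ <;> apply Complex.ofReal_injective <;> push_cast <;> rw [← hn]
  · linear_combination A11
  · linear_combination A21
  · linear_combination A31
  · linear_combination A4
  · linear_combination B1
  · linear_combination B5
  · linear_combination B7

theorem core2 {n : ℕ} (a b c d p q r : Fin n → ℂ) (k : ℝ) (hk : 0 < k)
    (hA : PolA (ff a b c d) (ff p q r 0))
    (hB : PolB (k : ℂ) (ff a b c d) (ff p q r 0) (gg a b c d) (gg p q r 0))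
    (hd : d ≠ 0) (m v : ℂ) (hr : r = 0) (hq : q = m • d)
    (hp : p = m • c + v • d) : False := by
  have hdd : hinner d d ≠ 0 := fun h => hd (hi_self_zero h)
  have xq : ∀ x, hinner x q = (starRingEnd ℂ) m * hinner x d := by
    intro x; rw [hq]; simp only [hi_smul_right]
  have xp : ∀ x, hinner x p = (starRingEnd ℂ) m * hinner x c
      + (starRingEnd ℂ) v * hinner x d := by
    intro x; rw [hp]; simp only [hi_add_right, hi_smul_right]
  have px : ∀ x, hinner p x = m * hinner c x + v * hinner d x := by
    intro x; rw [hp]; simp only [hi_add_left, hi_smul_left]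
  obtain ⟨A11, A12, A13, A14⟩ := rowA1 _ _ _ _ _ _ _ _ hA
  obtain ⟨A21, A22, A23⟩ := rowA2 _ _ _ _ _ _ _ _ hA
  obtain ⟨A31, A32⟩ := rowA3 _ _ _ _ _ _ _ _ hA
  have A4 := rowA4 _ _ _ _ _ _ _ _ hA
  obtain ⟨B1, B2, B3, B4, B5, B6⟩ := rowB _ _ _ _ _ _ _ _ _ hB
  subst hr
  have had : hinner a d = 0 := by simpa [hi_zero_right] using A14
  have hac : hinner a c = 0 := by simpa [hi_zero_right] using A13
  have hbc : hinner b c = 0 := by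
    rw [B2] at A22
    simpa [hi_zero_right] using A22
  simp only [wd, xq, xp, hi_zero_right, hi_zero_left, had, hac, hbc] at A12 A23 A32 B3 B6
  set M := (starRingEnd ℂ) m with hMdef
  set V := (starRingEnd ℂ) v with hVdef
  have h3 : M * hinner a b * hinner p d = 0 := by linear_combination B3 / 4
  have hbd : hinner b d = 0 := by linear_combination A23 - h3
  simp only [hbd] at A32 B6
  have hcd : hinner c d = 0 := by linear_combination A32 - B6 / 4
  have hpd : hinner p d = v * hinner d d := by rw [px, hcd]; ring
  obtain ⟨A, hA0, hAA, -⟩ := hi_self a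
  obtain ⟨B, hB0, hBB, -⟩ := hi_self b
  obtain ⟨C, hC0, hCC, -⟩ := hi_self c
  obtain ⟨E, hE0, hEE, -⟩ := hi_self d
  have ho : hinner a b = 0 → Orth a b c d A B C E := fun hab =>
    ⟨hAA, hBB, hCC, hEE, hab, hac, had, sym0 hab, hbc, hbd,
    sym0 hac, sym0 hbc, hcd, sym0 had, sym0 hbd, sym0 hcd⟩
  have hEn : E ≠ 0 := by
    rintro rfl
    exact hdd (by simpa using hEE)
  by_cases hm : m = 0
  · have hM : M = 0 := by rw [hMdef, hm, map_zero]
    have hab : hinner a b = 0 := by rw [hM] at A12; linear_combination A12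
    have o := ho hab
    have hp' : p = v • d := by rw [hp, hm]; module
    have hq' : q = 0 := by rw [hq, hm]; module
    clear xq xp px hp hq hpd h3
    subst hp' hq'
    have B7 := diagB2 _ _ _ _ _ _ _ _ _ _ o hB
    obtain ⟨aa, bb, cc, dd, ab, ac, ad, ba, bc, bd, ca, cb, cd, da, db, dc⟩ := o
    simp only [wd, hi_smul_left, hi_smul_right, hi_zero_left, hi_zero_right,
      aa, bb, cc, dd, ab, ac, ad, ba, bc, bd, ca, cb, cd, da, db, dc, mul_zero, zero_mul,
      add_zero, zero_add, sub_zero] at A11 A21 A31 A4 B1 B5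
    have hn : v * (starRingEnd ℂ) v = ((Complex.normSq v : ℝ) : ℂ) := Complex.mul_conj v
    refine real2 A B C E (Complex.normSq v) k hEn hk
      ?_ ?_ ?_ ?_ ?_ ?_ ?_ <;> apply Complex.ofReal_injective <;> push_cast <;> rw [← hn]
    · linear_combination A11
    · linear_combination A21
    · linear_combination A31
    · linear_combination A4
    · linear_combination B1
    · linear_combination B5
    · linear_combination B7
  · have hM : M ≠ 0 := conj_ne hm
    have hpd0 : hinner p d = 0 := by
      have : (M * M) * (hinner p d * hinner p d) = 0 := by
        linear_combination M * hinner p d * A12 - h3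
      exact mul_self_eq_zero.1 ((mul_eq_zero.1 this).resolve_left (mul_ne_zero hM hM))
    have hv : v = 0 := by
      rw [hpd0] at hpd
      exact (mul_eq_zero.1 hpd.symm).resolve_right hdd
    have hab : hinner a b = 0 := by rw [hpd0] at A12; linear_combination A12
    have o := ho hab
    have hp' : p = m • c := by rw [hp, hv]; module
    clear xq xp px hp hpd h3 hpd0
    subst hp' hq
    have B7 := diagB3 _ _ _ _ _ _ _ _ _ _ o hB
    obtain ⟨aa, bb, cc, dd, ab, ac, ad, ba, bc, bd, ca, cb, cd, da, db, dc⟩ := o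
    simp only [wd, hi_smul_left, hi_smul_right, hi_zero_left, hi_zero_right,
      aa, bb, cc, dd, ab, ac, ad, ba, bc, bd, ca, cb, cd, da, db, dc, mul_zero, zero_mul,
      add_zero, zero_add, sub_zero] at A11 A21 A31 A4 B1 B5
    have hn : m * (starRingEnd ℂ) m = ((Complex.normSq m : ℝ) : ℂ) := Complex.mul_conj m
    refine real3 A B C E (Complex.normSq m) k hA0 hB0 hC0 hE0 (Complex.normSq_nonneg _) hk
      ?_ ?_ ?_ ?_ ?_ ?_ ?_ ?_ <;> apply Complex.ofReal_injective <;> push_cast <;> rw [← hn]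
    · linear_combination A11
    · linear_combination A21
    · linear_combination A31
    · linear_combination A4
    · linear_combination B1
    · linear_combination B5
    · linear_combination B7.1
    · linear_combination B7.2

theorem core {n : ℕ} (a b c d p q r : Fin n → ℂ) (k : ℝ) (hk : 0 < k)
    (hA : PolA (ff a b c d) (ff p q r 0))
    (hB : PolB (k : ℂ) (ff a b c d) (ff p q r 0) (gg a b c d) (gg p q r 0)) : d = 0 := by
  by_contra hd
  obtain ⟨l, m, v, hr, hq, hp⟩ := param _ _ _ _ _ _ _ hA hd
  by_cases hl : l = 0
  · subst hl
    exact core2 a b c d p q r k hk hA hB hd m v (by rw [hr]; module) (by rw [hq]; module)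
      (by rw [hp]; module)
  · exact core1 a b c d p q r k hk hA hB hd l m v hr hq hp hl

theorem ff_lin {n : ℕ} (a b c d p q r s : Fin n → ℂ) (x y z : ℂ) :
    ff (x • a + y • p) (x • b + y • q) (x • c + y • r) (x • d + y • s) z =
      x • ff a b c d z + y • ff p q r s z := by
  simp only [ff]; module

theorem gg_lin {n : ℕ} (a b c d p q r s : Fin n → ℂ) (x y z : ℂ) :
    gg (x • a + y • p) (x • b + y • q) (x • c + y • r) (x • d + y • s) z =
      x • gg a b c d z + y • gg p q r s z := by
  simp only [gg]; module

theorem rotA {n : ℕ} (a b c d p q r s : Fin n → ℂ) (x y : ℂ)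
    (hxy : x * (starRingEnd ℂ) x + y * (starRingEnd ℂ) y = 1)
    (h : PolA (ff a b c d) (ff p q r s)) :
    PolA (ff (x • a + y • p) (x • b + y • q) (x • c + y • r) (x • d + y • s))
      (ff ((-(starRingEnd ℂ) y) • a + ((starRingEnd ℂ) x) • p)
        ((-(starRingEnd ℂ) y) • b + ((starRingEnd ℂ) x) • q)
        ((-(starRingEnd ℂ) y) • c + ((starRingEnd ℂ) x) • r)
        ((-(starRingEnd ℂ) y) • d + ((starRingEnd ℂ) x) • s)) := by
  intro z w
  have := h z w
  simp only [ff_lin]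
  generalize ff a b c d z = F1 at this ⊢
  generalize ff p q r s z = F2 at this ⊢
  generalize ff a b c d ((starRingEnd ℂ) w) = G1 at this ⊢
  generalize ff p q r s ((starRingEnd ℂ) w) = G2 at this ⊢
  rw [← this]
  simp only [hi_add_left, hi_add_right, hi_smul_left, hi_smul_right, map_neg, Complex.conj_conj]
  generalize (starRingEnd ℂ) x = x' at hxy ⊢
  generalize (starRingEnd ℂ) y = y' at hxy ⊢
  linear_combination (hinner F1 G1 + hinner F2 G2 + (1 + x * x' + y * y') *
    (hinner F1 G1 * hinner F2 G2 - hinner F1 G2 * hinner F2 G1)) * hxy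

theorem rotB {n : ℕ} (a b c d p q r s : Fin n → ℂ) (x y k : ℂ)
    (hxy : x * (starRingEnd ℂ) x + y * (starRingEnd ℂ) y = 1)
    (h : PolB k (ff a b c d) (ff p q r s) (gg a b c d) (gg p q r s)) :
    PolB k (ff (x • a + y • p) (x • b + y • q) (x • c + y • r) (x • d + y • s))
      (ff ((-(starRingEnd ℂ) y) • a + ((starRingEnd ℂ) x) • p)
        ((-(starRingEnd ℂ) y) • b + ((starRingEnd ℂ) x) • q)
        ((-(starRingEnd ℂ) y) • c + ((starRingEnd ℂ) x) • r)
        ((-(starRingEnd ℂ) y) • d + ((starRingEnd ℂ) x) • s))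
      (gg (x • a + y • p) (x • b + y • q) (x • c + y • r) (x • d + y • s))
      (gg ((-(starRingEnd ℂ) y) • a + ((starRingEnd ℂ) x) • p)
        ((-(starRingEnd ℂ) y) • b + ((starRingEnd ℂ) x) • q)
        ((-(starRingEnd ℂ) y) • c + ((starRingEnd ℂ) x) • r)
        ((-(starRingEnd ℂ) y) • d + ((starRingEnd ℂ) x) • s)) := by
  intro z w
  have := h z w
  simp only [ff_lin, gg_lin]
  generalize ff a b c d z = F1 at this ⊢
  generalize ff p q r s z = F2 at this ⊢
  generalize ff a b c d ((starRingEnd ℂ) w) = G1 at this ⊢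
  generalize ff p q r s ((starRingEnd ℂ) w) = G2 at this ⊢
  generalize gg a b c d z = H1 at this ⊢
  generalize gg p q r s z = H2 at this ⊢
  generalize gg a b c d ((starRingEnd ℂ) w) = K1 at this ⊢
  generalize gg p q r s ((starRingEnd ℂ) w) = K2 at this ⊢
  rw [← this]
  obtain ⟨x', hx'⟩ : ∃ x', (starRingEnd ℂ) x = x' := ⟨_, rfl⟩
  obtain ⟨y', hy'⟩ : ∃ y', (starRingEnd ℂ) y = y' := ⟨_, rfl⟩
  have hx2 : (starRingEnd ℂ) x' = x := by rw [← hx', Complex.conj_conj]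
  have hy2 : (starRingEnd ℂ) y' = y := by rw [← hy', Complex.conj_conj]
  simp only [hx', hy'] at hxy ⊢
  have e : MB (x • F1 + y • F2) ((-y') • F1 + x' • F2) (x • H1 + y • H2) ((-y') • H1 + x' • H2)
      (x • G1 + y • G2) ((-y') • G1 + x' • G2) (x • K1 + y • K2) ((-y') • K1 + x' • K2) =
      !![x, y, 0, 0; -y', x', 0, 0; 0, 0, x, y; 0, 0, -y', x'] *
      MB F1 F2 H1 H2 G1 G2 K1 K2 *
      !![x', -y, 0, 0; y', x, 0, 0; 0, 0, x', -y; 0, 0, y', x] := by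
    ext i j
    fin_cases i <;> fin_cases j <;>
      simp [MB, Matrix.mul_apply, Fin.sum_univ_four, hi_add_left, hi_add_right, hi_smul_left,
        hi_smul_right, hx', hy', hx2, hy2, -neg_smul] <;> first
      | ring1
      | linear_combination hxy
      | linear_combination - hxy
  rw [e, Matrix.det_mul, Matrix.det_mul]
  have d1 : (!![x, y, 0, 0; -y', x', 0, 0; 0, 0, x, y; 0, 0, -y', x'] :
      Matrix (Fin 4) (Fin 4) ℂ).det = 1 := by
    simp only [det4, Matrix.of_apply, Matrix.cons_val', Matrix.cons_val_zero,
            Matrix.cons_val_one, Matrix.cons_val]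
    linear_combination (1 + x * x' + y * y') * hxy
  have d2 : (!![x', -y, 0, 0; y', x, 0, 0; 0, 0, x', -y; 0, 0, y', x] :
      Matrix (Fin 4) (Fin 4) ℂ).det = 1 := by
    simp only [det4, Matrix.of_apply, Matrix.cons_val', Matrix.cons_val_zero,
            Matrix.cons_val_one, Matrix.cons_val]
    linear_combination (1 + x * x' + y * y') * hxy
  rw [d1, d2, one_mul, mul_one]

theorem exists_rot {n : ℕ} (d s : Fin n → ℂ) (h : wd d s d s = 0) :
    ∃ x y : ℂ, x * (starRingEnd ℂ) x + y * (starRingEnd ℂ) y = 1 ∧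
      (-(starRingEnd ℂ) y) • d + ((starRingEnd ℂ) x) • s = 0 := by
  by_cases hd : d = 0
  · exact ⟨0, 1, by simp, by simp [hd]⟩
  obtain ⟨k, hk⟩ := hi_dep hd h
  have h0 : 0 < 1 + Complex.normSq k := by have := Complex.normSq_nonneg k; linarith
  have ht : (1 / Real.sqrt (1 + Complex.normSq k)) ^ 2 * (1 + Complex.normSq k) = 1 := by
    rw [div_pow, Real.sq_sqrt h0.le]; field_simp
  generalize 1 / Real.sqrt (1 + Complex.normSq k) = t at ht
  have ht' : (t : ℂ) ^ 2 * (1 + k * (starRingEnd ℂ) k) = 1 := by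
    rw [Complex.mul_conj]; exact_mod_cast ht
  refine ⟨t, t * (starRingEnd ℂ) k, ?_, ?_⟩
  · simp only [map_mul, Complex.conj_ofReal, Complex.conj_conj]
    linear_combination ht'
  · simp only [map_mul, Complex.conj_ofReal, Complex.conj_conj, hk]
    module

theorem stmt9 (n : ℕ) (hn : 0 < n) (a11 a21 a12 a22 a13 a23 a14 a24 : Fin n → ℂ)
    (c : ℝ) (hc : 0 < c)
    (hA : CondA 4 (fun z => z • a11 + z ^ 2 • a12 + z ^ 3 • a13 + z ^ 4 • a14)
      (fun z => z • a21 + z ^ 2 • a22 + z ^ 3 • a23 + z ^ 4 • a24))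
    (hB : CondB 4 c (fun z => z • a11 + z ^ 2 • a12 + z ^ 3 • a13 + z ^ 4 • a14)
      (fun z => z • a21 + z ^ 2 • a22 + z ^ 3 • a23 + z ^ 4 • a24)) :
    a14 = 0 ∧ a24 = 0 := by
  have pA := polA_of a11 a12 a13 a14 a21 a22 a23 a24 hA
  have pB := polB_of c a11 a12 a13 a14 a21 a22 a23 a24 hB
  obtain ⟨x, y, hxy, h0⟩ := exists_rot a14 a24 (rowA8 _ _ _ _ _ _ _ _ pA)
  have rA := rotA _ _ _ _ _ _ _ _ x y hxy pA
  have rB := rotB _ _ _ _ _ _ _ _ x y _ hxy pB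
  rw [h0] at rA rB
  have h1 := core _ _ _ _ _ _ _ c hc rA rB
  constructor
  · have : a14 = (x * (starRingEnd ℂ) x + y * (starRingEnd ℂ) y) • a14 := by rw [hxy, one_smul]
    rw [this]
    calc _ = (starRingEnd ℂ) x • (x • a14 + y • a24)
        - y • ((-(starRingEnd ℂ) y) • a14 + ((starRingEnd ℂ) x) • a24) := by module
      _ = 0 := by rw [h0, h1]; simp
  · have : a24 = (x * (starRingEnd ℂ) x + y * (starRingEnd ℂ) y) • a24 := by rw [hxy, one_smul]
    rw [this]
    calc _ = (starRingEnd ℂ) y • (x • a14 + y • a24)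
        + x • ((-(starRingEnd ℂ) y) • a14 + ((starRingEnd ℂ) x) • a24) := by module
      _ = 0 := by rw [h0, h1]; simp
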